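/- Assume f is continuous on (0,∞). Let z : (0,∞) → ℝ be continuously differentiable with lim_{t→0+} z(t) = 0, such that f·z' is integrable on (0,t] for every t > 0 and z'(r) = φ(r)ᵀ·∫_0^r f(v)·z'(v) dv for every r > 0. Then there exists a vector y ∈ ℝⁿ such that z(t) = yᵀ·∫_0^t f(s) ds for all t > 0. -/

import Mathlib

open MeasureTheory Filter Topology Matrix

theorem hasDerivAt_setIntegral_Ioc {h : ℝ → ℝ} {a t : ℝ} (hat : a < t)
    (hc : ContinuousOn h (Set.Ioi a)) (hi : ∀ t > a, IntegrableOn h (Set.Ioc a t)) :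
    HasDerivAt (fun t => ∫ s in Set.Ioc a t, h s) (h t) t := by
  have hca : ContinuousAt h t := hc.continuousAt (Ioi_mem_nhds hat)
  have hd : HasDerivAt (fun t => ∫ s in a..t, h s) (h t) t :=
    intervalIntegral.integral_hasDerivAt_right
      ((intervalIntegrable_iff_integrableOn_Ioc_of_le hat.le).2 (hi t hat))
      (hc.stronglyMeasurableAtFilter isOpen_Ioi t hat) hca
  refine hd.congr_of_eventuallyEq ?_
  filter_upwards [Ioi_mem_nhds hat] with u hu
  exact (intervalIntegral.integral_of_le (le_of_lt hu)).symm

theorem integrableOn_mul_of_sq {X : Type*} [MeasurableSpace X] {μ : Measure X} {g h : X → ℝ}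
    {s : Set X} (hg : Measurable g) (hh : Measurable h)
    (hg2 : IntegrableOn (fun x => g x ^ 2) s μ) (hh2 : IntegrableOn (fun x => h x ^ 2) s μ) :
    IntegrableOn (fun x => g x * h x) s μ :=
  ((memLp_two_iff_integrable_sq hg.aestronglyMeasurable).2 hg2).integrable_mul
    ((memLp_two_iff_integrable_sq hh.aestronglyMeasurable).2 hh2)

theorem hasDerivAt_continuousAt_mul_zero {a g : ℝ → ℝ} {t : ℝ} (ha : ContinuousAt a t)
    (hg : HasDerivAt g 0 t) (hgt : g t = 0) : HasDerivAt (fun s => a s * g s) 0 t := by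
  rw [hasDerivAt_iff_isLittleO] at hg ⊢
  simp only [hgt, sub_zero, smul_zero, mul_zero] at hg ⊢
  simpa using (ha.isBigO_one ℝ).mul_isLittleO hg

/-- If `c' = A' *ᵥ (A⁻¹ *ᵥ c)` at `t`, then `A⁻¹ *ᵥ c` has zero derivative at `t`. -/
theorem hasDerivAt_inv_mulVec_zero {ι : Type*} [Fintype ι] [DecidableEq ι]
    {A : ℝ → Matrix ι ι ℝ} {A' : Matrix ι ι ℝ} {c : ℝ → ι → ℝ} {t : ℝ}
    (hA : ∀ i j, HasDerivAt (fun s => A s i j) (A' i j) t)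
    (hu : ∀ᶠ s in 𝓝 t, IsUnit (A s))
    (hc : ∀ i, HasDerivAt (fun s => c s i) ((A' *ᵥ ((A t)⁻¹ *ᵥ c t)) i) t) (i : ι) :
    HasDerivAt (fun s => ((A s)⁻¹ *ᵥ c s) i) 0 t := by
  set y := (A t)⁻¹ *ᵥ c t with hy
  have hut : IsUnit (A t).det := (Matrix.isUnit_iff_isUnit_det _).1 hu.self_of_nhds
  have hAc : ContinuousAt A t :=
    continuousAt_pi.2 fun i => continuousAt_pi.2 fun j => (hA i j).continuousAt
  have hg : ∀ j, HasDerivAt (fun s => c s j - (A s *ᵥ y) j) 0 t := by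
    intro j
    have h : HasDerivAt (fun s => (A s *ᵥ y) j) ((A' *ᵥ y) j) t :=
      HasDerivAt.fun_sum fun k _ => (hA j k).mul_const (y k)
    simpa using (hc j).fun_sub h
  have hg0 : ∀ j, c t j - (A t *ᵥ y) j = 0 := by
    intro j
    rw [hy, Matrix.mulVec_mulVec, Matrix.mul_nonsing_inv _ hut, Matrix.one_mulVec, sub_self]
  have hAinv : ContinuousAt (fun s => (A s)⁻¹) t :=
    (continuousAt_matrix_inv (A t) (NormedRing.inverse_continuousAt hut.unit)).comp hAc
  have hinv : ∀ j, ContinuousAt (fun s => (A s)⁻¹ i j) t := fun j =>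
    continuousAt_pi.1 (continuousAt_pi.1 hAinv i) j
  have hsum : HasDerivAt (fun s => ∑ j, (A s)⁻¹ i j * (c s j - (A s *ᵥ y) j)) 0 t := by
    simpa using HasDerivAt.fun_sum (u := Finset.univ) fun j _ =>
      hasDerivAt_continuousAt_mul_zero (hinv j) (hg j) (hg0 j)
  refine (hsum.add_const (y i)).congr_of_eventuallyEq ?_
  filter_upwards [hu] with s hs
  have hs' : IsUnit (A s).det := (Matrix.isUnit_iff_isUnit_det _).1 hs
  have h : ∑ j, (A s)⁻¹ i j * (c s j - (A s *ᵥ y) j) = ((A s)⁻¹ *ᵥ (c s - A s *ᵥ y)) i := rfl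
  rw [h, Matrix.mulVec_sub, Matrix.mulVec_mulVec, Matrix.nonsing_inv_mul _ hs',
    Matrix.one_mulVec, Pi.sub_apply, sub_add_cancel]

/-- Assume f is continuous on (0,∞). Let z : (0,∞) → ℝ be continuously differentiable with
lim_{t→0+} z(t) = 0, such that f·z' is integrable on (0,t] for every t > 0 and
z'(r) = φ(r)ᵀ·∫_0^r f(v)·z'(v) dv for every r > 0. Then there exists y ∈ ℝⁿ with
z(t) = yᵀ·∫_0^t f(s) ds for all t > 0. -/
theorem homogeneous_solution_is_linear_combination
    (n : ℕ) (hn : 1 ≤ n)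
    (f : ℝ → Fin n → ℝ)
    (hf_meas : ∀ i, Measurable fun s => f s i)
    (hf_cont : ∀ i, ContinuousOn (fun s => f s i) (Set.Ioi 0))
    (hf_loc : ∀ i, ∀ t > (0 : ℝ), IntegrableOn (fun s => (f s i) ^ 2) (Set.Ioc 0 t))
    (m : ℝ → Matrix (Fin n) (Fin n) ℝ)
    (hm : ∀ t, m t = Matrix.of fun i j => ∫ s in Set.Ioc 0 t, f s i * f s j)
    (hm_inv : ∀ t > (0 : ℝ), IsUnit (m t))
    (α : ℝ → Matrix (Fin n) (Fin n) ℝ)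
    (hα : ∀ t, α t = (m t)⁻¹)
    (φ : ℝ → Fin n → ℝ)
    (hφ : ∀ t, φ t = (α t).mulVec (f t))
    (z z' : ℝ → ℝ)
    (hz_deriv : ∀ t > (0 : ℝ), HasDerivAt z (z' t) t)
    (hz'_cont : ContinuousOn z' (Set.Ioi 0))
    (hz_zero : Tendsto z (𝓝[>] (0 : ℝ)) (𝓝 0))
    (hfz'_int : ∀ i, ∀ t > (0 : ℝ), IntegrableOn (fun v => f v i * z' v) (Set.Ioc 0 t))
    (hz'_eq : ∀ r > (0 : ℝ),
      z' r = φ r ⬝ᵥ (fun i => ∫ v in Set.Ioc 0 r, f v i * z' v)) :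
    ∃ y : Fin n → ℝ, ∀ t > (0 : ℝ),
      z t = y ⬝ᵥ (fun i => ∫ s in Set.Ioc 0 t, f s i) := by
  have hff_int : ∀ i j, ∀ t > (0 : ℝ), IntegrableOn (fun s => f s i * f s j) (Set.Ioc 0 t) :=
    fun i j t ht => integrableOn_mul_of_sq (hf_meas i) (hf_meas j) (hf_loc i t ht) (hf_loc j t ht)
  have hf_int : ∀ i, ∀ t > (0 : ℝ), IntegrableOn (fun s => f s i) (Set.Ioc 0 t) := by
    intro i t ht
    simpa using integrableOn_mul_of_sq (h := fun _ => 1) (hf_meas i) measurable_const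
      (hf_loc i t ht) (by simp)
  set c : ℝ → Fin n → ℝ := fun r i => ∫ v in Set.Ioc 0 r, f v i * z' v with hc_def
  have hz'_inv : ∀ r > (0 : ℝ), z' r = f r ⬝ᵥ ((m r)⁻¹ *ᵥ c r) := by
    intro r hr
    have hsymm : ((m r)⁻¹)ᵀ = (m r)⁻¹ := by
      rw [Matrix.transpose_nonsing_inv]
      congr 1
      ext i j
      simp [hm, mul_comm]
    rw [hz'_eq r hr, hφ, hα, ← Matrix.vecMul_transpose, hsymm, Matrix.dotProduct_mulVec]
  have hm_deriv : ∀ t > (0 : ℝ), ∀ i j,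
      HasDerivAt (fun s => m s i j) (Matrix.vecMulVec (f t) (f t) i j) t := by
    intro t ht i j
    simp only [hm, Matrix.of_apply, Matrix.vecMulVec_apply]
    exact hasDerivAt_setIntegral_Ioc ht ((hf_cont i).mul (hf_cont j)) (hff_int i j)
  have hc_deriv : ∀ t > (0 : ℝ), ∀ i, HasDerivAt (fun s => c s i)
      ((Matrix.vecMulVec (f t) (f t) *ᵥ ((m t)⁻¹ *ᵥ c t)) i) t := by
    intro t ht i
    have h : (Matrix.vecMulVec (f t) (f t) *ᵥ ((m t)⁻¹ *ᵥ c t)) i = f t i * z' t := by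
      rw [hz'_inv t ht]
      simp only [Matrix.mulVec, dotProduct, Matrix.vecMulVec_apply, Finset.mul_sum, mul_assoc]
    rw [h]
    exact hasDerivAt_setIntegral_Ioc ht ((hf_cont i).mul hz'_cont) (hfz'_int i)
  have hy_deriv : ∀ t > (0 : ℝ), ∀ i, HasDerivAt (fun s => ((m s)⁻¹ *ᵥ c s) i) 0 t :=
    fun t ht => hasDerivAt_inv_mulVec_zero (hm_deriv t ht)
      (Filter.mem_of_superset (Ioi_mem_nhds ht) hm_inv) (hc_deriv t ht)
  have hy_const : ∀ t > (0 : ℝ), (m t)⁻¹ *ᵥ c t = (m 1)⁻¹ *ᵥ c 1 := by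
    intro t ht
    ext i
    exact isOpen_Ioi.is_const_of_deriv_eq_zero isPreconnected_Ioi
      (fun s hs => (hy_deriv s hs i).differentiableAt.differentiableWithinAt)
      (fun s hs => (hy_deriv s hs i).deriv) ht (Set.mem_Ioi.2 one_pos)
  refine ⟨(m 1)⁻¹ *ᵥ c 1, fun t ht => ?_⟩
  set y := (m 1)⁻¹ *ᵥ c 1
  have hz'_y : ∀ r > (0 : ℝ), z' r = ∑ i, y i * f r i := by
    intro r hr
    rw [hz'_inv r hr, hy_const r hr, dotProduct_comm]
    rfl
  have hsum_int : IntegrableOn (fun s => ∑ i, y i * f s i) (Set.Ioc 0 t) :=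
    integrable_finsetSum _ fun i _ => (hf_int i t ht).const_mul (y i)
  have hftc := intervalIntegral.integral_eq_sub_of_hasDerivAt_of_tendsto ht
    (fun s hs => hz'_y s hs.1 ▸ hz_deriv s hs.1)
    ((intervalIntegrable_iff_integrableOn_Ioc_of_le ht.le).2 hsum_int) hz_zero
    ((hz_deriv t ht).continuousAt.tendsto.mono_left nhdsWithin_le_nhds)
  rw [sub_zero, intervalIntegral.integral_of_le ht.le,
    integral_finsetSum _ fun i _ => (hf_int i t ht).const_mul (y i)] at hftc
  simp only [integral_const_mul] at hftc
  exact hftc.symm
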